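/- arXiv:1809.02917 — 2 statements merged into one kernel-verified Lean document; each statement's English description precedes it below -/
import Mathlib

section
/- Corollary (gateway-independent optimal pricing). Suppose x* solves UPM(h) and (x*, λ, μ) is a KKT point of UPM(h) with λ_j = 0 for all j. Then there exists a hybrid price matrix h̃ that is gateway-independent — i.e., for every user i the sum h̃_{i←j} + c_{i←j} takes the same value for all gateways j — such that x* is an optimal solution of UPM(h̃) (admitting KKT multipliers with all shadow prices zero) and h̃_{i←j} = h_{i←j} whenever x*_{i←j} > 0; in particular the total operator profit under (h̃, x*) equals that under (h, x*). -/
open Finset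

/-- A traffic matrix `x` is feasible: nonnegative entries and downlink capacity constraints. -/
def Feasible {m : ℕ} (C : Fin m → ℝ) (x : Fin m → Fin m → ℝ) : Prop :=
  (∀ i j, 0 ≤ x i j) ∧ ∀ j, ∑ i, x i j ≤ C j

/-- Users' total payoff in UPM(hp), with hybrid prices `hp` and energy costs `c`. -/
noncomputable def payoff {m : ℕ} (U : Fin m → ℝ → ℝ) (hp c : Fin m → Fin m → ℝ)
    (x : Fin m → Fin m → ℝ) : ℝ :=
  ∑ i, U i (∑ l, x i l) - ∑ i, ∑ j, (hp i j + c i j) * x i j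

/-- `x` is an optimal solution of the users' payoff maximization problem UPM(hp). -/
def OptUPM {m : ℕ} (U : Fin m → ℝ → ℝ) (hp c : Fin m → Fin m → ℝ) (C : Fin m → ℝ)
    (x : Fin m → Fin m → ℝ) : Prop :=
  Feasible C x ∧ ∀ y, Feasible C y → payoff U hp c y ≤ payoff U hp c x

/-- Total operator profit of the price matrix `hp` at traffic `x`, with operational costs `e`. -/
noncomputable def totalProfit {m : ℕ} (hp : Fin m → Fin m → ℝ) (e : Fin m → ℝ)
    (x : Fin m → Fin m → ℝ) : ℝ :=
  ∑ i, ∑ j, (hp i j - e j) * x i j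

/-- KKT point of UPM(hp). -/
def KKTpoint {m : ℕ} (U' : Fin m → ℝ → ℝ) (hp c : Fin m → Fin m → ℝ) (C : Fin m → ℝ)
    (x : Fin m → Fin m → ℝ) (lam : Fin m → ℝ) (mu : Fin m → Fin m → ℝ) : Prop :=
  Feasible C x ∧ (∀ j, 0 ≤ lam j) ∧ (∀ i j, 0 ≤ mu i j) ∧
  (∀ i j, U' i (∑ l, x i l) - hp i j - c i j - lam j + mu i j = 0) ∧
  (∀ j, lam j * ((∑ i, x i j) - C j) = 0) ∧
  (∀ i j, x i j * mu i j = 0)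

/-- A concave function lies below its tangent lines. -/
theorem ConcaveOn.le_add_mul_sub_of_hasDerivWithinAt {S : Set ℝ} {f : ℝ → ℝ} {f' x y : ℝ}
    (hf : ConcaveOn ℝ S f) (hx : x ∈ S) (hy : y ∈ S) (hf' : HasDerivWithinAt f f' S x) :
    f y ≤ f x + f' * (y - x) := by
  rcases lt_trichotomy x y with hxy | rfl | hxy
  · have h := hf.slope_le_of_hasDerivWithinAt hx hy hxy hf'
    rw [slope_def_field, div_le_iff₀ (sub_pos.2 hxy)] at h
    linarith
  · simp
  · have h := hf.le_slope_of_hasDerivWithinAt hy hx hxy hf'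
    rw [slope_def_field, le_div_iff₀ (sub_pos.2 hxy)] at h
    linarith

/-- The KKT conditions are sufficient for optimality in UPM(hp). -/
theorem KKTpoint.optUPM {m : ℕ} {U U' : Fin m → ℝ → ℝ} {hp c : Fin m → Fin m → ℝ}
    {C : Fin m → ℝ} {x : Fin m → Fin m → ℝ} {lam : Fin m → ℝ} {mu : Fin m → Fin m → ℝ}
    (hU : ∀ i, ConcaveOn ℝ (Set.Ici 0) (U i))
    (hU' : ∀ i x, 0 ≤ x → HasDerivWithinAt (U i) (U' i x) (Set.Ici 0) x)
    (h : KKTpoint U' hp c C x lam mu) : OptUPM U hp c C x := by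
  obtain ⟨hx, hlam, hmu, hstat, hcap, hcompl⟩ := h
  refine ⟨hx, fun y hy => ?_⟩
  have hsum : ∀ {z : Fin m → Fin m → ℝ}, Feasible C z → ∀ i, 0 ≤ ∑ l, z i l :=
    fun hz i => sum_nonneg fun l _ => hz.1 i l
  have hutil : ∑ i, U i (∑ l, y i l) ≤
      ∑ i, U i (∑ l, x i l) + ∑ i, ∑ j, U' i (∑ l, x i l) * (y i j - x i j) := by
    rw [← sum_add_distrib]
    refine sum_le_sum fun i _ => ?_
    rw [← mul_sum, sum_sub_distrib]
    exact (hU i).le_add_mul_sub_of_hasDerivWithinAt (hsum hx i) (hsum hy i)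
      (hU' i _ (hsum hx i))
  have hmarg : ∑ i, ∑ j, U' i (∑ l, x i l) * (y i j - x i j) ≤
      ∑ i, ∑ j, (hp i j + c i j) * y i j - ∑ i, ∑ j, (hp i j + c i j) * x i j +
        ∑ i, ∑ j, lam j * (y i j - x i j) := by
    simp only [← sum_sub_distrib, ← sum_add_distrib]
    refine sum_le_sum fun i _ => sum_le_sum fun j _ => ?_
    linear_combination (y i j - x i j) * hstat i j + mul_nonneg (hmu i j) (hy.1 i j) +
      hcompl i j
  have hshadow : ∑ i, ∑ j, lam j * (y i j - x i j) ≤ 0 := by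
    rw [sum_comm]
    refine sum_nonpos fun j _ => ?_
    rw [← mul_sum, sum_sub_distrib]
    linear_combination mul_le_mul_of_nonneg_left (hy.2 j) (hlam j) - hcap j
  unfold payoff
  linarith

/-- **Corollary (gateway-independent optimal pricing).**  If `x` solves UPM(hp) with a KKT
point whose shadow prices all vanish, then there is a gateway-independent price matrix `ht`
(for each user the sum of price and energy cost is the same across gateways) for which `x`
is still optimal (with all-zero shadow prices), which agrees with `hp` on the support of `x`;
in particular the total operator profit is unchanged. -/
theorem gateway_independent_optimal_pricing
    (m : ℕ) (hm : 0 < m)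
    (U U' : Fin m → ℝ → ℝ) (hp c : Fin m → Fin m → ℝ)
    (C e : Fin m → ℝ) (hC : ∀ j, 0 < C j) (he : ∀ j, 0 ≤ e j)
    (hc : ∀ i j, 0 ≤ c i j)
    (hUconc : ∀ i, StrictConcaveOn ℝ (Set.Ici (0:ℝ)) (U i))
    (hUmono : ∀ i, StrictMonoOn (U i) (Set.Ici (0:ℝ)))
    (hU' : ∀ i x, 0 ≤ x → HasDerivWithinAt (U i) (U' i x) (Set.Ici 0) x)
    (x : Fin m → Fin m → ℝ) (lam : Fin m → ℝ) (mu : Fin m → Fin m → ℝ)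
    (hopt : OptUPM U hp c C x)
    (hKKT : KKTpoint U' hp c C x lam mu)
    (hlam : ∀ j, lam j = 0) :
    ∃ ht : Fin m → Fin m → ℝ,
      (∀ i j k, ht i j + c i j = ht i k + c i k) ∧
      OptUPM U ht c C x ∧
      (∃ mu' : Fin m → Fin m → ℝ, KKTpoint U' ht c C x (fun _ => 0) mu') ∧
      (∀ i j, 0 < x i j → ht i j = hp i j) ∧
      totalProfit ht e x = totalProfit hp e x := by
  obtain ⟨hx, -, -, hstat, -, hcompl⟩ := hKKT
  have hkkt : KKTpoint U' (fun i j => U' i (∑ l, x i l) - c i j) c C x (fun _ => 0)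
      (fun _ _ => 0) := by
    refine ⟨hx, ?_, ?_, ?_, ?_, ?_⟩ <;> intros <;> simp
  have hsupp : ∀ i j, 0 < x i j → U' i (∑ l, x i l) - c i j = hp i j := by
    intro i j hij
    have hmu : mu i j = 0 := (mul_eq_zero.1 (hcompl i j)).resolve_left hij.ne'
    linarith [hstat i j, hlam j]
  refine ⟨_, fun i j k => by ring, hkkt.optUPM (fun i => (hUconc i).concaveOn) hU', ⟨_, hkkt⟩,
    hsupp, sum_congr rfl fun i _ => sum_congr rfl fun j _ => ?_⟩
  rcases (hx.1 i j).eq_or_lt with hij | hij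
  · simp [← hij]
  · simp only [hsupp i j hij]
end

section
/- Theorem (equivalence of R-OPM and OPM). Assume each user i's utility U_i is strictly concave, strictly increasing and continuously differentiable, and U_i'(0) > min_{j∈I} ẽ_{i←j} for every i, where ẽ_{i←j} = e_j + c_{i←j}. Let x^R be an optimal solution of (R-OPM): maximize Σ_{i,j∈I} (U_i'(Σ_{l∈I} x_{i←l}) − ẽ_{i←j}) x_{i←j} over matrices x ≥ 0 with Σ_{i∈I} x_{i←j} ≤ C_j for every j. Define the delivered price p*_i = U_i'(Σ_{l∈I} x^R_{i←l}) for each i and the hybrid price matrix h* by h*_{i←j} = p*_i − c_{i←j}. Then: (i) x^R is an optimal solution of UPM(h*); and (ii) the total operator profit Σ_{i,j}(h*_{i←j} − e_j) x^R_{i←j} equals the optimal value of (R-OPM), and for every gateway-independent nonnegative hybrid price matrix h' (i.e., h'_{i←j} + c_{i←j} independent of j for each i) and every solution x' of UPM(h') that minimizes Σ_{i,j} ẽ_{i←j} x'_{i←j} among the solutions of UPM(h'), one has Σ_{i,j}(h'_{i←j} − e_j) x'_{i←j} ≤ Σ_{i,j}(h*_{i←j} − e_j) x^R_{i←j}. 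-/
open Finset

/-- The objective of the revised operator profit maximization problem (R-OPM), where
`etilde i j = e j + c i j` is the delivered cost. -/
noncomputable def RopmObj {m : ℕ} (U' : Fin m → ℝ → ℝ) (etilde : Fin m → Fin m → ℝ)
    (x : Fin m → Fin m → ℝ) : ℝ :=
  ∑ i, ∑ j, (U' i (∑ l, x i l) - etilde i j) * x i j

open Filter Topology in
/-- A one-sided derivative at the right end point of an interval dominates `p` as soon as all
increments towards that point do. -/
lemma le_of_hasDerivWithinAt_of_increment {f : ℝ → ℝ} {f' p a s : ℝ} (ha : 0 < a) (has : a ≤ s)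
    (hf : HasDerivWithinAt f f' (Set.Ici 0) s)
    (h : ∀ t, 0 ≤ t → t ≤ a → f (s - t) + p * t ≤ f s) : p ≤ f' := by
  have hs : 0 < s := ha.trans_le has
  have hleft : HasDerivWithinAt f f' (Set.Iio s) s :=
    hf.mono_of_mem_nhdsWithin (mem_nhdsWithin_of_mem_nhds (Ici_mem_nhds hs))
  rw [hasDerivWithinAt_iff_tendsto_slope' (by simp)] at hleft
  refine ge_of_tendsto hleft ?_
  filter_upwards [Ioo_mem_nhdsLT (sub_lt_self s ha)] with z hz
  have hzs : 0 < s - z := sub_pos.2 hz.2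
  have hincr := h (s - z) hzs.le (by linarith [hz.1])
  rw [sub_sub_cancel] at hincr
  rw [slope_comm, slope_def_field, le_div_iff₀ hzs]
  linarith

/-- The graph of a concave function on the half-line lies below its tangent lines. -/
lemma ConcaveOn.le_tangent_of_hasDerivWithinAt {S : Set ℝ} {f : ℝ → ℝ} {f' s y : ℝ}
    (hf : ConcaveOn ℝ S f) (hs : s ∈ S) (hy : y ∈ S) (hf' : HasDerivWithinAt f f' S s) :
    f y ≤ f s + f' * (y - s) := by
  rcases lt_trichotomy s y with hsy | rfl | hys
  · have := hf.slope_le_of_hasDerivWithinAt hs hy hsy hf'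
    rw [slope_def_field, div_le_iff₀ (sub_pos.2 hsy)] at this
    linarith
  · simp
  · have := hf.le_slope_of_hasDerivWithinAt hy hs hys hf'
    rw [slope_def_field, le_div_iff₀ (sub_pos.2 hys)] at this
    linarith

/-- Lowering one traffic entry within its nonnegativity bound keeps the traffic feasible. -/
lemma Feasible.sub_single {m : ℕ} {C : Fin m → ℝ} {x : Fin m → Fin m → ℝ} (hx : Feasible C x)
    (i j : Fin m) {t : ℝ} (ht : 0 ≤ t) (htx : t ≤ x i j) :
    Feasible C (fun a b => x a b - if a = i ∧ b = j then t else 0) := by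
  refine ⟨fun a b => ?_, fun b => (sum_le_sum fun a _ => ?_).trans (hx.2 b)⟩
  · dsimp only
    split_ifs with hab
    · rw [hab.1, hab.2]
      linarith
    · simpa using hx.1 a b
  · dsimp only
    split_ifs <;> linarith

/-- The change of the users' payoff when one traffic entry is lowered by `t`. -/
lemma payoff_sub_single {m : ℕ} (U : Fin m → ℝ → ℝ) (hp c x : Fin m → Fin m → ℝ)
    (i j : Fin m) (t : ℝ) :
    payoff U hp c (fun a b => x a b - if a = i ∧ b = j then t else 0) - payoff U hp c x =
      U i (∑ l, x i l - t) - U i (∑ l, x i l) + (hp i j + c i j) * t := by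
  unfold payoff
  simp only [← sum_sub_distrib]
  rw [sum_eq_single i]
  · simp [sum_sub_distrib, mul_sub]
    ring
  · intro a _ hai
    simp [hai]
  · simp

/-- First-order optimality in UPM: on every route carrying traffic, the delivered price is at
most the marginal utility. -/
lemma OptUPM.price_le_marginal {m : ℕ} {U : Fin m → ℝ → ℝ} {hp c x : Fin m → Fin m → ℝ}
    {C : Fin m → ℝ} (hx : OptUPM U hp c C x) {i j : Fin m} (hij : 0 < x i j) {u' : ℝ}
    (hu : HasDerivWithinAt (U i) u' (Set.Ici 0) (∑ l, x i l)) : hp i j + c i j ≤ u' := by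
  refine le_of_hasDerivWithinAt_of_increment hij
    (single_le_sum (f := x i) (fun l _ => hx.1.1 i l) (mem_univ j)) hu fun t ht htx => ?_
  have hle := hx.2 _ (hx.1.sub_single i j ht htx)
  have hchange := payoff_sub_single U hp c x i j t
  linarith

/-- **Theorem (equivalence of R-OPM and OPM).**  Let `xR` solve (R-OPM), and set the delivered
prices `pstar i = U' i (∑ l, xR i l)` and hybrid prices `hstar i j = pstar i - c i j`.  Then
(i) `xR` solves UPM(hstar); (ii) the total operator profit of `(hstar, xR)` equals the optimal
value of (R-OPM), and no gateway-independent nonnegative price matrix, together with a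
delivered-cost-minimizing users' optimum, yields a larger total operator profit. -/
theorem ROPM_equiv_OPM
    (m : ℕ) (hm : 0 < m)
    (U U' : Fin m → ℝ → ℝ) (c : Fin m → Fin m → ℝ)
    (C e : Fin m → ℝ) (hC : ∀ j, 0 < C j) (he : ∀ j, 0 ≤ e j)
    (hc : ∀ i j, 0 ≤ c i j)
    (hUconc : ∀ i, StrictConcaveOn ℝ (Set.Ici (0:ℝ)) (U i))
    (hUmono : ∀ i, StrictMonoOn (U i) (Set.Ici (0:ℝ)))
    (hU' : ∀ i x, 0 ≤ x → HasDerivWithinAt (U i) (U' i x) (Set.Ici 0) x)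
    (hdemand : ∀ i, ∃ j, e j + c i j < U' i 0)
    (xR : Fin m → Fin m → ℝ)
    (hxRfeas : Feasible C xR)
    (hxRopt : ∀ y, Feasible C y →
      RopmObj U' (fun i j => e j + c i j) y ≤ RopmObj U' (fun i j => e j + c i j) xR)
    (pstar : Fin m → ℝ) (hpstar : ∀ i, pstar i = U' i (∑ l, xR i l))
    (hstar : Fin m → Fin m → ℝ) (hhstar : ∀ i j, hstar i j = pstar i - c i j) :
    OptUPM U hstar c C xR ∧
    totalProfit hstar e xR = RopmObj U' (fun i j => e j + c i j) xR ∧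
    ∀ h' : Fin m → Fin m → ℝ, (∀ i j, 0 ≤ h' i j) →
      (∀ i j k, h' i j + c i j = h' i k + c i k) →
      ∀ x', OptUPM U h' c C x' →
        (∀ y, OptUPM U h' c C y →
          (∑ i, ∑ j, (e j + c i j) * x' i j) ≤ ∑ i, ∑ j, (e j + c i j) * y i j) →
        totalProfit h' e x' ≤ totalProfit hstar e xR := by
  have hsum : ∀ {y}, Feasible C y → ∀ i, 0 ≤ ∑ l, y i l :=
    fun hy i => sum_nonneg fun l _ => hy.1 i l
  have heq : totalProfit hstar e xR = RopmObj U' (fun i j => e j + c i j) xR := by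
    refine sum_congr rfl fun i _ => sum_congr rfl fun j _ => ?_
    rw [hhstar, hpstar]
    ring
  refine ⟨⟨hxRfeas, fun y hy => ?_⟩, heq, fun h' _ _ x' hx' _ => ?_⟩
  · simp only [payoff, hhstar, sub_add_cancel, ← mul_sum, ← sum_sub_distrib]
    refine sum_le_sum fun i _ => ?_
    have htangent := (hUconc i).concaveOn.le_tangent_of_hasDerivWithinAt
      (hsum hxRfeas i) (hsum hy i) (hU' i _ (hsum hxRfeas i))
    rw [← hpstar] at htangent
    linarith
  · rw [heq]
    refine le_trans ?_ (hxRopt x' hx'.1)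
    refine sum_le_sum fun i _ => sum_le_sum fun j _ => ?_
    rcases (hx'.1.1 i j).eq_or_lt with hzero | hpos
    · simp [← hzero]
    · have hprice := hx'.price_le_marginal hpos (hU' i _ (hsum hx'.1 i))
      exact mul_le_mul_of_nonneg_right (by linarith) hpos.le
end
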